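/- Let τ > 0, q ∈ (0,1], and let M, μ, m > 0 and n ≥ 0 be real numbers with Mmμ > 1. Set x = (Mmμ)^{−(n+1)} ∈ (0,1). Then the ordinate of the lower-bound family point B′(m,n) satisfies q^n (1 − 1/e)^{n+1}/(mτ) ≤ (Mμ/(qτ)) · exp(−2·√(ln(1/(q(1−1/e)))·ln(1/x))), with equality when (n+1)² = ln(1/x)/ln(1/(q(1−1/e))). -/

import Mathlib

theorem rpow_mul_rpow_add_one_div_eq_exp {q c M m μ τ n : ℝ} (hq : 0 < q) (hc : 0 < c)
    (hM : 0 < M) (hμ : 0 < μ) (hm : 0 < m) :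
    q ^ n * c ^ (n + 1) / (m * τ) =
      M * μ / (q * τ) *
        Real.exp (-((n + 1) * Real.log (1 / (q * c)) + Real.log (M * m * μ))) := by
  have h : Real.exp (-((n + 1) * Real.log (1 / (q * c)) + Real.log (M * m * μ))) =
      q ^ n * q * c ^ (n + 1) / (M * m * μ) := by
    rw [neg_add, Real.exp_add, Real.exp_neg (Real.log _), Real.exp_log (by positivity),
      one_div, Real.log_inv, mul_neg, neg_neg, mul_comm (n + 1),
      ← Real.rpow_def_of_pos (by positivity), Real.mul_rpow hq.le hc.le,
      Real.rpow_add_one hq.ne', div_eq_mul_inv]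
  rw [h]
  rcases eq_or_ne τ 0 with rfl | hτ
  · simp
  · field_simp

theorem two_mul_sqrt_mul_le_add {u v : ℝ} (hu : 0 ≤ u) (hv : 0 ≤ v) :
    2 * Real.sqrt (u * v) ≤ u + v := by
  rw [Real.sqrt_mul hu]
  nlinarith [sq_nonneg (Real.sqrt u - Real.sqrt v), Real.sq_sqrt hu, Real.sq_sqrt hv]


/-- the ordinate of the lower-bound family `B′(m,n)` at
`x = (Mmμ)^{−(n+1)}` lies below the envelope curve
`y = (Mμ/(qτ)) exp(−2√(ln(1/(q(1−1/e)))·ln(1/x)))`, with equality when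
`(n+1)² = ln(1/x)/ln(1/(q(1−1/e)))`. -/
theorem stmt7 (τ q M μ m n : ℝ) (hτ : 0 < τ) (hq : q ∈ Set.Ioc (0:ℝ) 1)
    (hM : 0 < M) (hμ : 0 < μ) (hm : 0 < m) (hn : 0 ≤ n) (hMmμ : 1 < M * m * μ)
    (x : ℝ) (hx : x = (M * m * μ) ^ (-(n + 1))) :
    q ^ n * (1 - 1 / Real.exp 1) ^ (n + 1) / (m * τ)
        ≤ (M * μ / (q * τ)) *
            Real.exp (-2 * Real.sqrt (Real.log (1 / (q * (1 - 1 / Real.exp 1))) * Real.log (1 / x))) ∧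
    ((n + 1) ^ 2 = Real.log (1 / x) / Real.log (1 / (q * (1 - 1 / Real.exp 1))) →
      q ^ n * (1 - 1 / Real.exp 1) ^ (n + 1) / (m * τ)
        = (M * μ / (q * τ)) *
            Real.exp (-2 * Real.sqrt (Real.log (1 / (q * (1 - 1 / Real.exp 1))) * Real.log (1 / x)))) := by
  obtain ⟨hq0, hq1⟩ := hq
  have he : 1 / Real.exp 1 < 1 := by
    rw [div_lt_one (Real.exp_pos 1)]
    exact Real.one_lt_exp_iff.mpr one_pos
  have he' : 0 < 1 / Real.exp 1 := by positivity
  have hc : 0 < 1 - 1 / Real.exp 1 := by linarith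
  have ha : 0 < Real.log (1 / (q * (1 - 1 / Real.exp 1))) := by
    apply Real.log_pos
    rw [lt_div_iff₀ (by positivity)]
    nlinarith
  have hb : 0 < Real.log (M * m * μ) := Real.log_pos hMmμ
  have hlog : Real.log (1 / x) = (n + 1) * Real.log (M * m * μ) := by
    rw [one_div, Real.log_inv, hx, Real.log_rpow (by positivity)]
    ring
  rw [rpow_mul_rpow_add_one_div_eq_exp hq0 hc hM hμ hm, hlog]
  generalize Real.log (1 / (q * (1 - 1 / Real.exp 1))) = a at *
  generalize Real.log (M * m * μ) = b at *
  have hab : a * ((n + 1) * b) = (n + 1) * a * b := by ring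
  have hna : 0 ≤ (n + 1) * a := by positivity
  rw [hab]
  constructor
  · gcongr
    linarith [two_mul_sqrt_mul_le_add hna hb.le]
  · intro h
    have hb_eq : (n + 1) * a = b := by
      rw [eq_div_iff ha.ne'] at h
      have hn' : n + 1 ≠ 0 := by positivity
      apply mul_left_cancel₀ hn'
      linarith
    rw [hb_eq, Real.sqrt_mul_self hb.le]
    congr 2
    ring
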